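/- arXiv:2602.13883 — 2 statements merged into one kernel-verified Lean document; each statement's English description precedes it below -/
import Mathlib

section
/- Let A be a compact (or open) subset of [0,1]² and {i,j} = {1,2}. Then A connects the i-th opposite faces of [0,1]² if and only if A separates the j-th opposite faces of [0,1]². -/
def unitCube (n : ℕ) : Set (Fin n → ℝ) := Set.Icc 0 1

def face (n : ℕ) (i : Fin n) (v : ℝ) : Set (Fin n → ℝ) := {x ∈ unitCube n | x i = v}

/-- `A` connects the `i`-th opposite faces of the unit cube: some connected subset of `A`
meets both faces. -/
def Connects (n : ℕ) (i : Fin n) (A : Set (Fin n → ℝ)) : Prop :=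
  ∃ S ⊆ A, IsPreconnected S ∧ (S ∩ face n i 0).Nonempty ∧ (S ∩ face n i 1).Nonempty

/-- `A` separates the `i`-th opposite faces of the unit cube. -/
def Separates (n : ℕ) (i : Fin n) (A : Set (Fin n → ℝ)) : Prop :=
  ¬ Connects n i (unitCube n \ A)

/-- `U` is open in the subspace topology of the unit cube. -/
def OpenInCube (n : ℕ) (U : Set (Fin n → ℝ)) : Prop :=
  ∃ V : Set (Fin n → ℝ), IsOpen V ∧ U = V ∩ unitCube n

open Set

/-- A continuous function with nonnegative sine stays in one interval of nonnegativity. -/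
lemma sin_band (h : ℝ → ℝ) (hc : Continuous h) (hs : ∀ t, 0 ≤ Real.sin (h t)) :
    ∃ k : ℤ, ∀ t, 2 * k * Real.pi ≤ h t ∧ h t ≤ 2 * k * Real.pi + Real.pi := by
  have hpi := Real.pi_pos
  refine ⟨⌊h 0 / (2 * Real.pi)⌋, ?_⟩
  set k : ℤ := ⌊h 0 / (2 * Real.pi)⌋ with hk
  have h1 : 2 * k * Real.pi ≤ h 0 := by
    have := Int.floor_le (h 0 / (2 * Real.pi))
    rw [← hk, le_div_iff₀ (by positivity)] at this
    linarith
  have h2 : h 0 < 2 * k * Real.pi + 2 * Real.pi := by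
    have := Int.lt_floor_add_one (h 0 / (2 * Real.pi))
    rw [← hk, div_lt_iff₀ (by positivity)] at this
    linarith
  have hrange : ∀ a b y, h a ≤ y → y ≤ h b → 0 ≤ Real.sin y := by
    intro a b y hay hyb
    obtain ⟨t, ht⟩ := mem_range_of_exists_le_of_exists_ge hc ⟨a, hay⟩ ⟨b, hyb⟩
    rw [← ht]; exact hs t
  have neg : ∀ y, 2 * k * Real.pi - Real.pi < y → y < 2 * k * Real.pi → Real.sin y < 0 := by
    intro y hy1 hy2
    have e : Real.sin y = Real.sin (y - k * (2 * Real.pi)) := (Real.sin_sub_int_mul_two_pi y k).symm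
    rw [e]
    exact Real.sin_neg_of_neg_of_neg_pi_lt (by linarith) (by linarith)
  have neg' : ∀ y, 2 * k * Real.pi + Real.pi < y → y < 2 * k * Real.pi + 2 * Real.pi →
      Real.sin y < 0 := by
    intro y hy1 hy2
    rw [← Real.sin_sub_two_pi]
    exact neg _ (by linarith) (by linarith)
  have h3 : h 0 ≤ 2 * k * Real.pi + Real.pi := by
    by_contra hh
    exact absurd (hs 0) (not_le.2 (neg' _ (not_le.1 hh) h2))
  intro t
  constructor
  · by_contra hh
    have hh := not_le.1 hh
    have := hrange t 0 (max (h t) (2 * k * Real.pi - Real.pi / 2)) (le_max_left _ _)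
      (max_le (by linarith) (by linarith))
    exact absurd this (not_le.2 (neg _ (lt_max_of_lt_right (by linarith))
      (max_lt hh (by linarith))))
  · by_contra hh
    have hh := not_le.1 hh
    have := hrange 0 t (min (h t) (2 * k * Real.pi + 3 * Real.pi / 2))
      (le_min (by linarith) (by linarith)) (min_le_left _ _)
    exact absurd this (not_le.2 (neg' _ (lt_min hh (by linarith))
      (min_lt_of_right_lt (by linarith))))

/-- Two-dimensional Poincaré–Miranda theorem. -/
lemma miranda (f g : ℝ × ℝ → ℝ) (hf : Continuous f) (hg : Continuous g)
    (f0 : ∀ t ∈ Icc (0:ℝ) 1, f (0, t) ≤ 0) (f1 : ∀ t ∈ Icc (0:ℝ) 1, 0 ≤ f (1, t))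
    (g0 : ∀ t ∈ Icc (0:ℝ) 1, g (t, 0) ≤ 0) (g1 : ∀ t ∈ Icc (0:ℝ) 1, 0 ≤ g (t, 1)) :
    ∃ s ∈ Icc (0:ℝ) 1, ∃ t ∈ Icc (0:ℝ) 1, f (s, t) = 0 ∧ g (s, t) = 0 := by
  by_contra hcon
  push Not at hcon
  set c : ℝ → ℝ := fun x => max 0 (min 1 x) with hc
  have cc : Continuous c := by fun_prop
  have cI : ∀ x, c x ∈ Icc (0:ℝ) 1 := fun x =>
    ⟨le_max_left _ _, max_le zero_le_one (min_le_left _ _)⟩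
  have c0 : c 0 = 0 := by simp [hc]
  have c1 : c 1 = 1 := by simp [hc]
  let F : C(ℝ × ℝ, ℂ) := ⟨fun p => (f (c p.1, c p.2) : ℂ) + (g (c p.1, c p.2) : ℂ) * Complex.I,
    by fun_prop⟩
  have Fre : ∀ p, (F p).re = f (c p.1, c p.2) := by intro p; simp [F]
  have Fim : ∀ p, (F p).im = g (c p.1, c p.2) := by intro p; simp [F]
  have hne : ∀ p, F p ≠ 0 := by
    intro p hp
    refine hcon _ (cI p.1) _ (cI p.2) ?_ ?_
    · rw [← Fre, hp]; rfl
    · rw [← Fim, hp]; rfl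
  obtain ⟨L, ⟨-, hL⟩, -⟩ := Complex.isCoveringMapOn_exp.existsUnique_continuousMap_lifts F
    (a₀ := (0, 0)) (Complex.exp_log (hne _)) (fun p => hne p)
  have hL' : ∀ p, Complex.exp (L p) = F p := fun p => congrFun hL p
  let θ : ℝ → ℝ → ℝ := fun s t => (L (s, t)).im
  have cosθ : ∀ s t, f (c s, c t) = Real.exp (L (s, t)).re * Real.cos (θ s t) := by
    intro s t
    rw [← Complex.exp_re, hL', Fre]
  have sinθ : ∀ s t, g (c s, c t) = Real.exp (L (s, t)).re * Real.sin (θ s t) := by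
    intro s t
    rw [← Complex.exp_im, hL', Fim]
  have hpi := Real.pi_pos
  -- the four edges
  obtain ⟨k, hk⟩ := sin_band (fun t => θ t 0 + Real.pi) (by fun_prop) (by
    intro t
    have := g0 _ (cI t)
    have e := sinθ t 0
    rw [c0] at e
    rw [e] at this
    have := nonpos_of_mul_nonpos_right this (Real.exp_pos _)
    rw [Real.sin_add_pi]; linarith)
  obtain ⟨m, hm⟩ := sin_band (fun t => θ 1 t + Real.pi / 2) (by fun_prop) (by
    intro t
    have := f1 _ (cI t)
    rw [← c1, cosθ] at this
    rw [Real.sin_add_pi_div_two]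
    exact nonneg_of_mul_nonneg_right this (Real.exp_pos _))
  obtain ⟨n, hn⟩ := sin_band (fun t => θ t 1) (by fun_prop) (by
    intro t
    have := g1 _ (cI t)
    rw [← c1, sinθ] at this
    exact nonneg_of_mul_nonneg_right this (Real.exp_pos _))
  obtain ⟨p, hp⟩ := sin_band (fun t => θ 0 t - Real.pi / 2) (by fun_prop) (by
    intro t
    have := f0 _ (cI t)
    have e := cosθ 0 t
    rw [c0] at e
    rw [e] at this
    have := nonpos_of_mul_nonpos_right this (Real.exp_pos _)
    rw [Real.sin_sub_pi_div_two]; linarith)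
  have key : ∀ a b : ℤ, (2 * a * Real.pi < 2 * b * Real.pi + 2 * Real.pi) → a ≤ b := by
    intro a b h
    have : (a : ℝ) < b + 1 := by
      by_contra hh
      nlinarith [not_lt.1 hh]
    have : a < b + 1 := by exact_mod_cast this
    omega
  have hk0 := hk 0
  have hk1 := hk 1
  have hm0 := hm 0
  have hm1 := hm 1
  have hn0 := hn 0
  have hn1 := hn 1
  have hp0 := hp 0
  have hp1 := hp 1
  have e1 : k = m := le_antisymm (key _ _ (by linarith)) (key _ _ (by linarith))
  have e2 : n = m := le_antisymm (key _ _ (by linarith)) (key _ _ (by linarith))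
  have e3 : p = n := le_antisymm (key _ _ (by linarith)) (key _ _ (by linarith))
  subst e1 e2 e3
  linarith

/-- Separation of quasi-components in compact Hausdorff spaces. -/
lemma clopen_sep {X : Type*} [TopologicalSpace X] [T2Space X] [CompactSpace X] (P Q : Set X)
    (hP : IsClosed P) (hQ : IsClosed Q)
    (h : ∀ p ∈ P, ∀ q ∈ Q, q ∉ connectedComponent p) :
    ∃ Z : Set X, IsClopen Z ∧ P ⊆ Z ∧ Disjoint Z Q := by
  have step : ∀ p ∈ P, ∃ Z : Set X, IsClopen Z ∧ p ∈ Z ∧ Disjoint Z Q := by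
    intro p hp
    have hh : Q ∩ ⋂ s : { s : Set X // IsClopen s ∧ p ∈ s }, (s : Set X) = ∅ := by
      rw [← connectedComponent_eq_iInter_isClopen]
      exact eq_empty_of_forall_notMem fun q hq => h p hp q hq.1 hq.2
    obtain ⟨u, hu⟩ := hQ.isCompact.elim_finite_subfamily_closed
        _ (fun s : { s : Set X // IsClopen s ∧ p ∈ s } => s.2.1.1) hh
    refine ⟨⋂ i ∈ u, (i : Set X), isClopen_biInter_finset fun i _ => i.2.1, ?_, ?_⟩
    · simp only [mem_iInter]
      exact fun i _ => i.2.2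
    · rw [disjoint_comm, disjoint_iff_inter_eq_empty]; exact hu
  choose! Z hZ using step
  obtain ⟨t, ht, htP⟩ := hP.isCompact.elim_nhds_subcover Z
    (fun p hp => (hZ p hp).1.isOpen.mem_nhds (hZ p hp).2.1)
  refine ⟨⋃ p ∈ t, Z p, isClopen_biUnion_finset fun i hi => (hZ i (ht i hi)).1, htP, ?_⟩
  simp only [disjoint_iUnion_left]
  exact fun i hi => (hZ i (ht i hi)).2.2

/-- If no connected subset of the compact `K` joins `P` and `Q`, there is a continuous function
which is `0` on `P`, `1` on `Q` and takes only these values on `K`. -/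
lemma sep_fun {E : Type*} [TopologicalSpace E] [T2Space E] [NormalSpace E] (K P Q : Set E)
    (hK : IsCompact K) (hP : IsClosed P) (hQ : IsClosed Q) (hPQ : Disjoint P Q)
    (hno : ∀ S ⊆ K, IsPreconnected S → (S ∩ P).Nonempty → (S ∩ Q).Nonempty → False) :
    ∃ f : E → ℝ, Continuous f ∧ (∀ x ∈ P, f x = 0) ∧ (∀ x ∈ Q, f x = 1) ∧
      ∀ x ∈ K, f x = 0 ∨ f x = 1 := by
  have : CompactSpace K := isCompact_iff_compactSpace.1 hK
  obtain ⟨Z, hZ, hPZ, hQZ⟩ := clopen_sep (X := K) ((↑) ⁻¹' P) ((↑) ⁻¹' Q)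
    (hP.preimage continuous_subtype_val) (hQ.preimage continuous_subtype_val) (by
      intro p hp q hq hpq
      refine hno ((↑) '' connectedComponent p) ?_
        (isPreconnected_connectedComponent.image _ continuous_subtype_val.continuousOn)
        ⟨p, ⟨p, mem_connectedComponent, rfl⟩, hp⟩ ⟨q, ⟨q, hpq, rfl⟩, hq⟩
      rintro _ ⟨x, -, rfl⟩
      exact x.2)
  have c0 : IsClosed ((↑) '' Z : Set E) :=
    hK.isClosed.isClosedEmbedding_subtypeVal.isClosedMap _ hZ.isClosed
  have c1 : IsClosed ((↑) '' Zᶜ : Set E) :=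
    hK.isClosed.isClosedEmbedding_subtypeVal.isClosedMap _ hZ.compl.isClosed
  obtain ⟨f, hf0, hf1, -⟩ := exists_continuous_zero_one_of_isClosed (hP.union c0) (hQ.union c1) (by
    rw [Set.disjoint_left]
    rintro x (hx | ⟨a, ha, rfl⟩) (hx' | ⟨b, hb, hbx⟩)
    · exact Set.disjoint_left.1 hPQ hx hx'
    · subst hbx; exact hb (hPZ hx)
    · exact Set.disjoint_left.1 hQZ ha hx'
    · rw [Subtype.ext hbx] at hb
      exact hb ha)
  refine ⟨f, f.continuous, fun x hx => hf0 (Or.inl hx), fun x hx => hf1 (Or.inl hx), ?_⟩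
  intro x hx
  by_cases h : (⟨x, hx⟩ : K) ∈ Z
  · exact Or.inl (hf0 (Or.inr ⟨_, h, rfl⟩))
  · exact Or.inr (hf1 (Or.inr ⟨_, h, rfl⟩))

lemma cube_mem (x : Fin 2 → ℝ) (hx : x ∈ unitCube 2) (k : Fin 2) : 0 ≤ x k ∧ x k ≤ 1 :=
  ⟨hx.1 k, hx.2 k⟩

lemma cube_closed : IsClosed (unitCube 2) := isClosed_Icc

lemma face_closed (i : Fin 2) (v : ℝ) : IsClosed (face 2 i v) :=
  cube_closed.inter (isClosed_eq (continuous_apply i) continuous_const)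

lemma face_disj (i : Fin 2) : Disjoint (face 2 i 0) (face 2 i 1) := by
  rw [Set.disjoint_left]
  rintro x ⟨-, h0⟩ ⟨-, h1⟩
  rw [h0] at h1
  exact zero_ne_one h1

/-- A preconnected subset of a relatively open subset of the square can be replaced by a path. -/
lemma exists_path (V S : Set (Fin 2 → ℝ)) (hV : IsOpen V) (hSV : S ⊆ V) (hSc : S ⊆ unitCube 2)
    (hS : IsPreconnected S) (a b : Fin 2 → ℝ) (ha : a ∈ S) (hb : b ∈ S) :
    ∃ γ : ℝ → Fin 2 → ℝ, Continuous γ ∧ γ 0 = a ∧ γ 1 = b ∧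
      ∀ t, γ t ∈ V ∩ unitCube 2 := by
  let r : (Fin 2 → ℝ) → (Fin 2 → ℝ) := fun x => 0 ⊔ (1 ⊓ x)
  have rc : Continuous r := continuous_pi fun k =>
    (continuous_const (y := (0:ℝ))).max ((continuous_const (y := (1:ℝ))).min (continuous_apply k))
  have rI : ∀ x, r x ∈ unitCube 2 := fun x =>
    ⟨le_sup_left, sup_le zero_le_one inf_le_left⟩
  have rid : ∀ x ∈ unitCube 2, r x = x := by
    intro x hx
    have h1 : x ≤ 1 := hx.2
    have h0 : 0 ≤ x := hx.1
    simp only [r, inf_eq_right.2 h1, sup_eq_right.2 h0]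
  have hW : IsOpen (r ⁻¹' V) := hV.preimage rc
  have hSW : S ⊆ r ⁻¹' V := fun x hx => by
    rw [mem_preimage, rid x (hSc hx)]; exact hSV hx
  have hC : IsOpen (connectedComponentIn (r ⁻¹' V) a) := hW.connectedComponentIn
  have hconn : IsConnected (connectedComponentIn (r ⁻¹' V) a) :=
    isConnected_connectedComponentIn_iff.2 (hSW ha)
  have hp := (hC.isConnected_iff_isPathConnected).1 hconn
  have hSC := hS.subset_connectedComponentIn ha hSW
  obtain ⟨p, hpm⟩ := hp.joinedIn a (hSC ha) b (hSC hb)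
  refine ⟨fun t => r (p.extend t), rc.comp p.continuous_extend, ?_, ?_, ?_⟩
  · simp [rid a (hSc ha)]
  · simp [rid b (hSc hb)]
  · intro t
    refine ⟨?_, rI _⟩
    exact connectedComponentIn_subset (r ⁻¹' V) a (hpm (projIcc 0 1 zero_le_one t))

lemma not_both (i j : Fin 2) (hij : i ≠ j) (K : Set (Fin 2 → ℝ)) (hK : IsCompact K)
    (hKc : K ⊆ unitCube 2) (h1 : Connects 2 i K) (h2 : Connects 2 j (unitCube 2 \ K)) : False := by
  obtain ⟨S, hSK, hS, ⟨a, haS, ha⟩, ⟨b, hbS, hb⟩⟩ := h1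
  obtain ⟨T, hTK, hT, ⟨a', haT, ha'⟩, ⟨b', hbT, hb'⟩⟩ := h2
  obtain ⟨γ, γc, γ0, γ1, hγ⟩ := exists_path Kᶜ T hK.isClosed.isOpen_compl
    (fun x hx => (hTK hx).2) (fun x hx => (hTK hx).1) hT a' b' haT hbT
  have hcomp : IsCompact (γ '' Icc 0 1) := isCompact_Icc.image γc
  obtain ⟨δ, δc, δ0, δ1, hδ⟩ := exists_path (γ '' Icc 0 1)ᶜ S hcomp.isClosed.isOpen_compl
    (by rintro x hx ⟨t, -, rfl⟩; exact (hγ t).1 (hSK hx)) (hSK.trans hKc) hS a b haS hbS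
  have cγ := fun t => cube_mem _ (hγ t).2
  have cδ := fun t => cube_mem _ (hδ t).2
  obtain ⟨s, hs, t, ht, e1, e2⟩ := miranda (fun p => γ p.1 j - δ p.2 j) (fun p => δ p.2 i - γ p.1 i)
    (by fun_prop) (by fun_prop)
    (by intro t _; simp only [γ0, ha'.2]; linarith [cδ t j])
    (by intro t _; simp only [γ1, hb'.2]; linarith [cδ t j])
    (by intro t _; simp only [δ0, ha.2]; linarith [cγ t i])
    (by intro t _; simp only [δ1, hb.2]; linarith [cγ t i])
  refine (hδ t).1 ⟨s, hs, ?_⟩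
  funext k
  have hk : k = i ∨ k = j := by omega
  simp only at e1 e2
  rcases hk with rfl | rfl <;> linarith

lemma one_of (i j : Fin 2) (hij : i ≠ j) (K : Set (Fin 2 → ℝ)) (hK : IsCompact K)
    (h1 : ¬ Connects 2 i K) : Connects 2 j (unitCube 2 \ K) := by
  obtain ⟨f, fc, f0, f1, fK⟩ := sep_fun K _ _ hK (face_closed i 0) (face_closed i 1) (face_disj i)
    (fun S hS hp h0 h1' => h1 ⟨S, hS, hp, h0, h1'⟩)
  by_contra h2
  have hM : IsCompact (unitCube 2 ∩ {x | f x = 1 / 2}) :=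
    IsCompact.inter_right isCompact_Icc (isClosed_eq fc continuous_const)
  obtain ⟨g, gc, g0, g1, gM⟩ := sep_fun _ _ _ hM (face_closed j 0) (face_closed j 1) (face_disj j)
    (fun S hS hp h0 h1' => h2 ⟨S, fun x hx => ⟨(hS hx).1, fun hxK => by
      have h3 : f x = 1 / 2 := (hS hx).2
      rcases fK x hxK with h | h <;> norm_num [h] at h3⟩, hp, h0, h1'⟩)
  let v : ℝ × ℝ → Fin 2 → ℝ := fun p k => if k = i then p.1 else p.2
  have vc : Continuous v := by
    refine continuous_pi fun k => ?_
    by_cases hk : k = i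
    · simp only [v, hk, if_true]; fun_prop
    · simp only [v, hk, if_false]; fun_prop
  have vi : ∀ p, v p i = p.1 := fun p => by simp [v]
  have vj : ∀ p, v p j = p.2 := fun p => by simp [v, hij.symm]
  have vI : ∀ s ∈ Icc (0:ℝ) 1, ∀ t ∈ Icc (0:ℝ) 1, v (s, t) ∈ unitCube 2 := by
    intro s hs t ht
    constructor <;> intro k <;> by_cases hk : k = i <;> simp [v, hk, hs.1, hs.2, ht.1, ht.2]
  have z : (0:ℝ) ∈ Icc (0:ℝ) 1 := by simp
  have o : (1:ℝ) ∈ Icc (0:ℝ) 1 := by simp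
  obtain ⟨s, hs, t, ht, e1, e2⟩ := miranda (fun p => f (v p) - 1 / 2) (fun p => g (v p) - 1 / 2)
    (by fun_prop) (by fun_prop)
    (by intro t ht; simp only [f0 _ ⟨vI 0 z t ht, vi _⟩]; norm_num)
    (by intro t ht; simp only [f1 _ ⟨vI 1 o t ht, vi _⟩]; norm_num)
    (by intro t ht; simp only [g0 _ ⟨vI t ht 0 z, vj _⟩]; norm_num)
    (by intro t ht; simp only [g1 _ ⟨vI t ht 1 o, vj _⟩]; norm_num)
  rcases gM (v (s, t)) ⟨vI s hs t ht, by simp only [mem_ofPred_eq]; linarith⟩ with h | h <;>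
    norm_num [h] at e2

theorem stmt14 (i j : Fin 2) (hij : i ≠ j) (A : Set (Fin 2 → ℝ)) (hA : A ⊆ unitCube 2)
    (hco : IsCompact A ∨ OpenInCube 2 A) :
    Connects 2 i A ↔ Separates 2 j A := by
  unfold Separates
  rcases hco with hK | ⟨V, hV, hAV⟩
  · refine ⟨fun h1 h2 => not_both i j hij A hK hA h1 h2, fun h => ?_⟩
    by_contra h1
    exact h (one_of i j hij A hK h1)
  · have hB : IsCompact (unitCube 2 \ A) := by
      have : unitCube 2 \ A = unitCube 2 ∩ Vᶜ := by
        rw [hAV]; ext x; simp only [mem_sdiff, mem_inter_iff, mem_compl_iff]; tauto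
      rw [this]
      exact IsCompact.inter_right isCompact_Icc hV.isClosed_compl
    have hBB : unitCube 2 \ (unitCube 2 \ A) = A := sdiff_sdiff_cancel_left hA
    constructor
    · intro h1 h2
      exact not_both j i hij.symm _ hB sdiff_subset h2 (by rw [hBB]; exact h1)
    · intro h
      have := one_of j i hij.symm _ hB h
      rwa [hBB] at this
end

section
/- (Lebesgue Covering Theorem) Let n ≥ 1 and F₁, …, F_n be closed subsets of [0,1]^n covering [0,1]^n. Then for some i ∈ {1,…,n}, there exists a connected component of F_i that intersects both faces {x : x_i = 0} and {x : x_i = 1}. -/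
open MeasureTheory Set Topology in
/-- the determinant of `1 + t M(x)`, integrated over a compact set, is polynomial in `t`. -/
theorem exists_poly_det {n : ℕ} (K : Set (Fin n → ℝ)) (hK : IsCompact K)
    (M : (Fin n → ℝ) → Matrix (Fin n) (Fin n) ℝ) (hM : Continuous M) :
    ∃ P : Polynomial ℝ, ∀ t : ℝ, P.eval t = ∫ x in K, (1 + t • M x).det := by
  classical
  refine ⟨∑ σ : Equiv.Perm (Fin n), ∑ s ∈ (Finset.univ : Finset (Fin n)).powerset,
    Polynomial.C (∫ x in K, ((Equiv.Perm.sign σ : ℤ) : ℝ) *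
      ((∏ i ∈ s, (1 : Matrix (Fin n) (Fin n) ℝ) (σ i) i) *
        ∏ i ∈ Finset.univ \ s, M x (σ i) i)) * Polynomial.X ^ (Finset.univ \ s).card, fun t => ?_⟩
  have hc : ∀ i j, Continuous fun x => M x i j := fun i j => hM.matrix_elem i j
  have e : ∀ x, (1 + t • M x).det = ∑ σ : Equiv.Perm (Fin n),
      ∑ s ∈ (Finset.univ : Finset (Fin n)).powerset, (((Equiv.Perm.sign σ : ℤ) : ℝ) *
      ((∏ i ∈ s, (1 : Matrix (Fin n) (Fin n) ℝ) (σ i) i) *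
        ∏ i ∈ Finset.univ \ s, M x (σ i) i)) * t ^ (Finset.univ \ s).card := by
    intro x
    rw [Matrix.det_apply']
    refine Finset.sum_congr rfl fun σ _ => ?_
    simp only [Matrix.add_apply, Matrix.smul_apply, smul_eq_mul]
    rw [Finset.prod_add, Finset.mul_sum]
    refine Finset.sum_congr rfl fun s _ => ?_
    rw [Finset.prod_mul_distrib, Finset.prod_const]
    ring
  have hi : ∀ (σ : Equiv.Perm (Fin n)) (s : Finset (Fin n)), IntegrableOn (fun x =>
      (((Equiv.Perm.sign σ : ℤ) : ℝ) *
      ((∏ i ∈ s, (1 : Matrix (Fin n) (Fin n) ℝ) (σ i) i) *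
        ∏ i ∈ Finset.univ \ s, M x (σ i) i)) * t ^ (Finset.univ \ s).card) K volume := by
    intro σ s
    refine ContinuousOn.integrableOn_compact hK ?_
    exact Continuous.continuousOn (by fun_prop)
  simp_rw [e]
  rw [integral_finsetSum _ fun σ _ => integrable_finsetSum _ fun s _ => hi σ s]
  rw [Polynomial.eval_finsetSum]
  refine Finset.sum_congr rfl fun σ _ => ?_
  rw [integral_finsetSum _ fun s _ => hi σ s, Polynomial.eval_finsetSum]
  refine Finset.sum_congr rfl fun s _ => ?_
  rw [integral_mul_const]
  simp

open MeasureTheory Set Topology in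
theorem det_not_zero {n : ℕ} (φ : (Fin n → ℝ) → (Fin n → ℝ)) (hφ : ContDiff ℝ 1 φ)
    (h0 : ∀ x ∈ unitCube n, ∀ i, x i = 0 → φ x i = 0)
    (h1 : ∀ x ∈ unitCube n, ∀ i, x i = 1 → φ x i = 1)
    (hdet : ∀ x ∈ unitCube n, (fderiv ℝ φ x).det = 0) : False := by
  classical
  set C := unitCube n with hC
  have hCc : IsCompact C := isCompact_Icc
  have hCm : MeasurableSet C := measurableSet_Icc
  set g : (Fin n → ℝ) → (Fin n → ℝ) := fun x => φ x - x with hg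
  have hgd : ContDiff ℝ 1 g := hφ.sub contDiff_id
  set D : (Fin n → ℝ) → ((Fin n → ℝ) →L[ℝ] (Fin n → ℝ)) := fderiv ℝ g with hD
  have hDc : Continuous D := hgd.continuous_fderiv one_ne_zero
  have hDd : ∀ x, HasFDerivAt g (D x) x := fun x =>
    (hgd.differentiable one_ne_zero x).hasFDerivAt
  set M : (Fin n → ℝ) → Matrix (Fin n) (Fin n) ℝ :=
    fun x => LinearMap.toMatrix' (D x : (Fin n → ℝ) →ₗ[ℝ] (Fin n → ℝ)) with hM
  have hMc : Continuous M := by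
    refine continuous_matrix fun i j => ?_
    simp only [hM, LinearMap.toMatrix'_apply]
    have : Continuous fun x => D x (Pi.single j (1:ℝ)) :=
      hDc.clm_apply continuous_const
    exact (continuous_apply i).comp this
  have hMdet : ∀ (t : ℝ) x, (1 + t • M x).det =
      (ContinuousLinearMap.id ℝ (Fin n → ℝ) + t • D x).det := by
    intro t x
    rw [ContinuousLinearMap.det, ← LinearMap.det_toMatrix']
    congr 1
    simp [hM]
  obtain ⟨P, hP⟩ := exists_poly_det C hCc M hMc
  -- Lipschitz constant
  obtain ⟨B, hB⟩ : ∃ B : NNReal, LipschitzOnWith B g C := by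
    obtain ⟨b, hb⟩ := hCc.exists_bound_of_continuousOn (f := D) hDc.continuousOn
    refine ⟨b.toNNReal, ?_⟩
    refine (convex_Icc _ _).lipschitzOnWith_of_nnnorm_fderiv_le (𝕜 := ℝ)
      (fun x _ => (hDd x).differentiableAt) fun x hx => ?_
    rw [← NNReal.coe_le_coe, coe_nnnorm]
    exact (hb x hx).trans (Real.le_coe_toNNReal b)
  -- clamp
  set c : (Fin n → ℝ) → (Fin n → ℝ) := fun x i => max 0 (min 1 (x i)) with hcdef
  have hcC : ∀ x, c x ∈ C := fun x =>
    ⟨fun i => le_max_left _ _, fun i => max_le zero_le_one (min_le_left _ _)⟩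
  have hcid : ∀ x ∈ C, c x = x := by
    intro x hx
    funext i
    have h1 : x i ≤ 1 := hx.2 i
    have h2 : 0 ≤ x i := hx.1 i
    simp [hcdef, h1, h2]
  have hcl : LipschitzWith 1 c := by
    refine LipschitzWith.of_dist_le_mul fun x y => ?_
    rw [NNReal.coe_one, one_mul, dist_pi_le_iff dist_nonneg]
    intro i
    refine le_trans ?_ (dist_le_pi_dist x y i)
    simp only [hcdef, Real.dist_eq]
    refine (abs_max_sub_max_le_max _ _ _ _).trans ?_
    simp only [sub_self, abs_zero]
    refine max_le (abs_nonneg _) ?_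
    refine (abs_min_sub_min_le_max _ _ _ _).trans ?_
    simp
  have hgc : LipschitzWith B (fun x => g (c x)) := by
    have := (hB.comp hcl.lipschitzOnWith (s := univ) (fun x _ => hcC x))
    rw [mul_one] at this
    exact lipschitzOnWith_univ.1 this
  have hgcd : ∀ x y, dist (g (c x)) (g (c y)) ≤ B * dist x y := hgc.dist_le_mul
  -- main claim for small t
  have hpos : ∀ᶠ t in 𝓝 (0:ℝ), ∀ x ∈ C, 0 < (1 + t • M x).det := by
    have hcont : Continuous fun p : ℝ × (Fin n → ℝ) => (1 + p.1 • M p.2).det := by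
      apply Continuous.matrix_det
      exact continuous_const.add (continuous_fst.smul (hMc.comp continuous_snd))
    refine hCc.eventually_forall_of_forall_eventually fun x _ => ?_
    exact hcont.continuousAt.eventually_const_lt (by simp)
  have hsm : ∀ᶠ t in 𝓝 (0:ℝ), |t| * (B:ℝ) < 1 := by
    have hcont : Continuous fun t : ℝ => |t| * (B:ℝ) := by fun_prop
    exact hcont.continuousAt.eventually_lt_const (by simp)
  have hone : ∀ᶠ t in 𝓝 (0:ℝ), P.eval t = 1 := by
    filter_upwards [hpos, hsm] with t hp ht
    rw [hP]
    set ψ : (Fin n → ℝ) → (Fin n → ℝ) := fun x => x + t • g (c x) with hψ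
    have hinj : Function.Injective ψ := by
      intro x y hxy
      by_contra hne
      have h1 : x - y = t • (g (c y) - g (c x)) := by
        simp only [hψ] at hxy
        rw [smul_sub, sub_eq_sub_iff_add_eq_add, add_comm (t • _) y]
        exact hxy
      have h2 : dist x y ≤ |t| * (B * dist x y) := by
        calc dist x y = |t| * dist (g (c y)) (g (c x)) := by
              rw [dist_eq_norm, h1, norm_smul, Real.norm_eq_abs, ← dist_eq_norm]
          _ ≤ |t| * (B * dist y x) := by
              gcongr
              exact hgcd y x
          _ = _ := by rw [dist_comm]
      have h3 : 0 < dist x y := dist_pos.2 hne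
      nlinarith
    have hsurj : Function.Surjective ψ := by
      intro y
      have hcw : ContractingWith (‖t‖₊ * B) (fun x => y - t • g (c x)) := by
        refine ⟨?_, ?_⟩
        · rw [← NNReal.coe_lt_coe]
          simpa using ht
        · refine LipschitzWith.of_dist_le_mul fun a b => ?_
          rw [dist_sub_left, dist_smul₀]
          rw [NNReal.coe_mul, coe_nnnorm, mul_assoc]
          gcongr
          exact hgcd a b
      refine ⟨hcw.fixedPoint, ?_⟩
      have := hcw.fixedPoint_isFixedPt
      simp only [Function.IsFixedPt] at this
      simp only [hψ]
      nth_rewrite 1 [← this]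
      simp
    have hout : ∀ x, ∀ i, (x i ≤ 0 → ψ x i = x i) ∧ (1 ≤ x i → ψ x i = x i) := by
      intro x i
      constructor
      · intro h
        have h2 : c x i = 0 := by
          simp only [hcdef]
          rw [max_eq_left]
          exact (min_le_right _ _).trans h
        have h3 : g (c x) i = 0 := by
          simp [hg, h0 _ (hcC x) i h2, h2]
        simp [hψ, h3]
      · intro h
        have h2 : c x i = 1 := by
          simp only [hcdef]
          rw [min_eq_left h, max_eq_right zero_le_one]
        have h3 : g (c x) i = 0 := by
          simp [hg, h1 _ (hcC x) i h2, h2]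
        simp [hψ, h3]
    have hmaps : ∀ x ∈ C, ψ x ∈ C := by
      intro x hx
      have hbd : ∀ i, ∀ v ∈ Icc (0:ℝ) 1, (v = 0 ∨ v = 1) →
          |t * g x i| ≤ |x i - v| := by
        intro i v hv hv'
        have hxv : Function.update x i v ∈ C := by
          refine ⟨fun j => ?_, fun j => ?_⟩
          · by_cases hj : j = i
            · subst hj; simpa using hv.1
            · simpa [hj] using hx.1 j
          · by_cases hj : j = i
            · subst hj; simpa using hv.2
            · simpa [hj] using hx.2 j
        have hg0 : g (Function.update x i v) i = 0 := by
          rcases hv' with rfl | rfl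
          · simp [hg, h0 _ hxv i (by simp)]
          · simp [hg, h1 _ hxv i (by simp)]
        have hd : dist x (Function.update x i v) ≤ |x i - v| := by
          rw [dist_pi_le_iff (abs_nonneg _)]
          intro j
          by_cases hj : j = i
          · subst hj; simp [Real.dist_eq]
          · simp [hj]
        have h2 : |g x i| ≤ B * |x i - v| := by
          have h3 := dist_le_pi_dist (g x) (g (Function.update x i v)) i
          rw [hg0, Real.dist_eq, sub_zero] at h3
          refine h3.trans ((hB.dist_le_mul _ hx _ hxv).trans ?_)
          gcongr
        rw [abs_mul]
        calc |t| * |g x i| ≤ |t| * (B * |x i - v|) := by gcongr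
          _ = (|t| * (B:ℝ)) * |x i - v| := by ring
          _ ≤ 1 * |x i - v| := by gcongr
          _ = _ := one_mul _
      have hψx : ∀ i, ψ x i = x i + t * g x i := fun i => by simp [hψ, hcid x hx]
      refine ⟨fun i => ?_, fun i => ?_⟩
      · have h2 := hbd i 0 (by simp) (Or.inl rfl)
        have h3 : 0 ≤ x i := hx.1 i
        rw [sub_zero, abs_of_nonneg h3] at h2
        have h4 := (abs_le.1 h2).1
        rw [hψx]
        simp only [Pi.zero_apply]
        linarith
      · have h2 := hbd i 1 (by simp) (Or.inr rfl)
        have h3 : x i ≤ 1 := hx.2 i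
        rw [abs_of_nonpos (show x i - 1 ≤ 0 by linarith)] at h2
        have h4 := (abs_le.1 h2).2
        rw [hψx]
        simp only [Pi.one_apply]
        linarith
    have himg : ψ '' C = C := by
      have key : ∀ x, ψ x ∈ C ↔ x ∈ C := by
        intro x
        constructor
        · intro hx
          refine ⟨fun i => ?_, fun i => ?_⟩
          · by_contra hlt
            have hlt' : x i < 0 := not_le.1 hlt
            have e := (hout x i).1 hlt'.le
            have h2 : 0 ≤ ψ x i := hx.1 i
            linarith
          · by_contra hlt
            have hlt' : 1 < x i := not_le.1 hlt
            have e := (hout x i).2 hlt'.le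
            have h2 : ψ x i ≤ 1 := hx.2 i
            linarith
        · intro hx
          exact hmaps x hx
      ext y
      constructor
      · rintro ⟨x, hx, rfl⟩
        exact (key x).2 hx
      · intro hy
        obtain ⟨x, rfl⟩ := hsurj y
        exact ⟨x, (key x).1 hy, rfl⟩
    have hder : ∀ x ∈ C, HasFDerivWithinAt ψ (ContinuousLinearMap.id ℝ (Fin n → ℝ) + t • D x) C x := by
      intro x hx
      have h := ((hasFDerivAt_id x).add ((hDd x).const_smul t)).hasFDerivWithinAt (s := C)
      refine h.congr (fun y hy => ?_) ?_
      · simp [hψ, hcid y hy]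
      · simp [hψ, hcid x hx]
    have hcv := integral_image_eq_integral_abs_det_fderiv_smul volume hCm hder
      hinj.injOn (fun _ => (1:ℝ))
    rw [himg] at hcv
    have hvol : ∫ x in C, (1:ℝ) = 1 := by
      simp [hC, unitCube, Measure.real, Real.volume_Icc_pi]
    rw [hvol] at hcv
    rw [hcv]
    refine setIntegral_congr_fun hCm fun x hx => ?_
    simp only [smul_eq_mul, mul_one]
    rw [← hMdet, abs_of_pos (hp x hx)]
  have hP1 : P = 1 := by
    refine Polynomial.eq_of_infinite_eval_eq _ _ ?_
    obtain ⟨ε, hε, hb⟩ := Metric.eventually_nhds_iff_ball.1 hone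
    rw [Real.ball_eq_Ioo] at hb
    refine (Set.Ioo_infinite (show 0 - ε < 0 + ε by linarith)).mono fun t ht => ?_
    simp [hb t ht]
  have := hP 1
  rw [hP1, Polynomial.eval_one] at this
  rw [setIntegral_congr_fun hCm (g := fun _ => (0:ℝ))] at this
  · simp at this
  · intro x hx
    simp only
    rw [hMdet]
    have : ContinuousLinearMap.id ℝ (Fin n → ℝ) + (1:ℝ) • D x = fderiv ℝ φ x := by
      have h := (hφ.differentiable one_ne_zero x).hasFDerivAt.sub (hasFDerivAt_id x)
      have h2 := h.unique (hDd x)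
      rw [← h2]; simp
    rw [this, hdet x hx]

open Set in
theorem exists_sep {n : ℕ} (i : Fin n) (F : Set (Fin n → ℝ)) (hcl : IsClosed F)
    (hsub : F ⊆ unitCube n)
    (h : ¬ ∃ x ∈ F, (connectedComponentIn F x ∩ face n i 0).Nonempty ∧
      (connectedComponentIn F x ∩ face n i 1).Nonempty) :
    ∃ A B : Set (Fin n → ℝ), IsClosed A ∧ IsClosed B ∧ Disjoint A B ∧ F ⊆ A ∪ B ∧
      face n i 0 ⊆ A ∧ face n i 1 ⊆ B := by
  have hFc : IsCompact F := isCompact_Icc.of_isClosed_subset hcl hsub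
  have : CompactSpace F := isCompact_iff_compactSpace.1 hFc
  have hface : ∀ v, IsClosed (face n i v) := fun v =>
    isClosed_Icc.inter (isClosed_eq (continuous_apply i) continuous_const)
  set P : Set F := Subtype.val ⁻¹' face n i 0
  set Q : Set F := Subtype.val ⁻¹' face n i 1
  have hP : IsClosed P := (hface 0).preimage continuous_subtype_val
  have hQ : IsClosed Q := (hface 1).preimage continuous_subtype_val
  set π : F → ConnectedComponents F := ConnectedComponents.mk
  have hπ : Continuous π := ConnectedComponents.continuous_coe
  have hPQ : π '' P ⊆ (π '' Q)ᶜ := by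
    rintro _ ⟨p, hp, rfl⟩ ⟨q, hq, hqp⟩
    apply h
    refine ⟨p, p.2, ⟨p, mem_connectedComponentIn p.2, hp⟩, ⟨q, ?_, hq⟩⟩
    rw [connectedComponentIn_eq_image p.2]
    exact ⟨q, ConnectedComponents.coe_eq_coe'.1 hqp, rfl⟩
  obtain ⟨Z, hZ, hPZ, hZQ⟩ := exists_clopen_of_closed_subset_open
    (hP.isCompact.image hπ).isClosed (hQ.isCompact.image hπ).isClosed.isOpen_compl hPQ
  have hW : IsClopen (π ⁻¹' Z) := hZ.preimage hπ
  have hA : IsClosed (Subtype.val '' (π ⁻¹' Z)) :=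
    hcl.isClosedEmbedding_subtypeVal.isClosedMap _ hW.1
  have hB : IsClosed (Subtype.val '' (π ⁻¹' Z)ᶜ) :=
    hcl.isClosedEmbedding_subtypeVal.isClosedMap _ hW.compl.1
  refine ⟨_, _, hA.union (hface 0), hB.union (hface 1), ?_, ?_, subset_union_right,
    subset_union_right⟩
  · rw [Set.disjoint_left]
    rintro _ (⟨a, ha, rfl⟩ | ha) (⟨b, hb, hab⟩ | hb)
    · rw [Subtype.val_injective hab] at hb
      exact hb ha
    · exact hZQ ha ⟨a, hb, rfl⟩
    · subst hab
      exact hb (hPZ ⟨b, ha, rfl⟩)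
    · have := ha.2.symm.trans hb.2
      exact zero_ne_one this
  · intro x hx
    by_cases hxZ : (⟨x, hx⟩ : F) ∈ π ⁻¹' Z
    · exact Or.inl (Or.inl ⟨_, hxZ, rfl⟩)
    · exact Or.inr (Or.inl ⟨_, hxZ, rfl⟩)

open scoped Manifold ContDiff in
theorem stmt17 {n : ℕ} (hn : 1 ≤ n) (F : Fin n → Set (Fin n → ℝ))
    (hcl : ∀ i, IsClosed (F i)) (hsub : ∀ i, F i ⊆ unitCube n)
    (hcover : unitCube n ⊆ ⋃ i, F i) :
    ∃ i, ∃ x ∈ F i,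
      (connectedComponentIn (F i) x ∩ face n i 0).Nonempty ∧
      (connectedComponentIn (F i) x ∩ face n i 1).Nonempty := by
  by_contra hcon
  rw [not_exists] at hcon
  choose A B hA hB hAB hF h0 h1 using fun i => exists_sep i (F i) (hcl i) (hsub i) (hcon i)
  have hex : ∀ i, ∃ f : (Fin n → ℝ) → ℝ, ContDiff ℝ 1 f ∧ (∀ x, f x ∈ Set.Icc 0 1) ∧
      (∀ x ∈ A i, f x = 0) ∧ (∀ x ∈ B i, f x = 1) := by
    intro i
    obtain ⟨f, hf0, hf1, hf⟩ := exists_contMDiffMap_zero_one_of_isClosed (n := 1)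
      𝓘(ℝ, Fin n → ℝ) (hA i) (hB i) (hAB i)
    exact ⟨f, f.contMDiff.contDiff, hf, hf0, hf1⟩
  choose f hfd hf01 hf0 hf1 using hex
  have hφd : ContDiff ℝ 1 (fun x i => f i x) := contDiff_pi.2 hfd
  refine det_not_zero (fun x i => f i x) hφd
    (fun x hx i hi => hf0 i x (h0 i ⟨hx, hi⟩)) (fun x hx i hi => hf1 i x (h1 i ⟨hx, hi⟩)) ?_
  intro x hx
  obtain ⟨i, hi⟩ := Set.mem_iUnion.1 (hcover hx)
  have hz : fderiv ℝ (f i) x = 0 := by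
    rcases hF i hi with h | h
    · refine IsLocalMin.fderiv_eq_zero (Filter.Eventually.of_forall fun y => ?_)
      rw [hf0 i x h]; exact (hf01 i y).1
    · refine IsLocalMax.fderiv_eq_zero (Filter.Eventually.of_forall fun y => ?_)
      rw [hf1 i x h]; exact (hf01 i y).2
  rw [ContinuousLinearMap.det, ← LinearMap.det_toMatrix']
  refine Matrix.det_eq_zero_of_row_eq_zero i fun j => ?_
  rw [LinearMap.toMatrix'_apply]
  have h := fderiv_pi (𝕜 := ℝ) (φ := fun i x => f i x) (x := x)
    (fun i => (hfd i).differentiable one_ne_zero x)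
  rw [h]
  simp [hz]
end
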